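/- arXiv:2405.20116 — 3 statements merged into one kernel-verified Lean document; each statement's English description precedes it below -/
import Mathlib

section
/- Let (Ω, F, P) be a probability space with a filtration F_0 ⊆ F_1 ⊆ … ⊆ F where F_0 is the trivial σ-algebra, and let (ξ_i)_{i≥1} be real random variables such that ξ_i is F_i-measurable, E[ξ_i | F_{i−1}] = 0 almost surely, and there exist constants b > 0 and σ² > 0 with E[|ξ_i|^m | F_{i−1}] ≤ (m!/2) · b^{m−2} · σ² almost surely for every integer m ≥ 2 and every i ≥ 1. Then for every c > 0 and every n ∈ ℕ, P( Σ_{i=1}^n ξ_i ≥ n·c ) ≤ exp( − n·c² / (2(b·c + σ²)) ). -/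
open MeasureTheory ProbabilityTheory Filter
open scoped ENNReal

lemma aux_tail (x : ℝ) : HasSum (fun m : ℕ => x ^ (m+2) / ((m+2).factorial : ℝ)) (Real.exp x - 1 - x) := by
  have h := NormedSpace.expSeries_div_hasSum_exp (𝔸 := ℝ) x
  rw [← Real.exp_eq_exp_ℝ] at h
  have h2 := (hasSum_nat_add_iff' (f := fun n : ℕ => x ^ n / (n.factorial : ℝ)) 2).2 h
  have e : Real.exp x - 1 - x =
      Real.exp x - ∑ i ∈ Finset.range 2, x ^ i / (i.factorial : ℝ) := by
    simp [Finset.sum_range_succ]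
    ring
  rw [e]
  exact h2

lemma aux_exp {Ω : Type*} {m0 : MeasurableSpace Ω} (ν : Measure Ω) [IsFiniteMeasure ν]
    (f : Ω → ℝ) (b s t : ℝ) (hb : 0 < b) (hs : 0 < s) (ht : 0 < t) (htb : t * b < 1)
    (hf : Integrable f ν) (hf0 : ∫ ω, f ω ∂ν = 0)
    (hfm : ∀ m : ℕ, 2 ≤ m → Integrable (fun ω => |f ω| ^ m) ν)
    (hmom : ∀ m : ℕ, 2 ≤ m → ∫ ω, |f ω| ^ m ∂ν ≤
      ((m.factorial : ℝ) / 2 * b ^ (m - 2) * s) * ν.real Set.univ) :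
    ∫⁻ ω, ENNReal.ofReal (Real.exp (t * f ω)) ∂ν ≤
      ENNReal.ofReal (Real.exp (t ^ 2 * s / (2 * (1 - t * b)))) * ν Set.univ := by
  set M := ν.real Set.univ with hM
  have hM0 : 0 ≤ M := measureReal_nonneg
  set L := t ^ 2 * s / (2 * (1 - t * b)) with hL
  have h1 : 0 < 1 - t * b := by linarith
  have hL0 : 0 ≤ L := by positivity
  have hnn : ∀ ω, 0 ≤ Real.exp (t * f ω) - 1 - t * f ω := fun ω => by
    linarith [Real.add_one_le_exp (t * f ω)]
  have hmeas : AEStronglyMeasurable (fun ω => Real.exp (t * f ω) - 1 - t * f ω) ν := by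
    have := (hf.aestronglyMeasurable.const_mul t)
    exact ((Real.continuous_exp.comp_aestronglyMeasurable this).sub
      aestronglyMeasurable_const).sub this
  have hpt : ∀ ω, ENNReal.ofReal (Real.exp (t * f ω) - 1 - t * f ω) ≤
      ∑' m : ℕ, ENNReal.ofReal (t ^ (m+2) / ((m+2).factorial : ℝ) * |f ω| ^ (m+2)) := by
    intro ω
    have e : ∀ m : ℕ, t ^ (m+2) / ((m+2).factorial : ℝ) * |f ω| ^ (m+2)
        = (t * |f ω|) ^ (m+2) / ((m+2).factorial : ℝ) := fun m => by rw [mul_pow]; ring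
    have hS := aux_tail (t * |f ω|)
    simp_rw [e]
    rw [← ENNReal.ofReal_tsum_of_nonneg (fun m => by positivity) hS.summable]
    apply ENNReal.ofReal_le_ofReal
    rw [← (aux_tail (t * f ω)).tsum_eq]
    refine (aux_tail (t * f ω)).summable.tsum_le_tsum (fun m => ?_) hS.summable
    gcongr ?_ / _
    refine (le_abs_self _).trans ?_
    rw [abs_pow, abs_mul, abs_of_pos ht]
  have hterm : ∀ m : ℕ, ∫⁻ ω, ENNReal.ofReal (t ^ (m+2) / ((m+2).factorial : ℝ) * |f ω| ^ (m+2)) ∂ν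
      ≤ ENNReal.ofReal (t ^ 2 * s / 2 * M * (t * b) ^ m) := by
    intro m
    rw [← ofReal_integral_eq_lintegral_ofReal ((hfm (m+2) (by omega)).const_mul _)
      (Eventually.of_forall fun ω => by positivity)]
    apply ENNReal.ofReal_le_ofReal
    rw [integral_const_mul]
    have h := hmom (m+2) (by omega)
    have hF : (0:ℝ) < ((m+2).factorial : ℝ) := by positivity
    calc _ ≤ t ^ (m+2) / ((m+2).factorial : ℝ) *
          ((((m+2).factorial : ℝ) / 2 * b ^ (m + 2 - 2) * s) * M) := by gcongr
      _ = _ := by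
        rw [Nat.add_sub_cancel]; field_simp
        try ring
  have hlint : ∫⁻ ω, ENNReal.ofReal (Real.exp (t * f ω) - 1 - t * f ω) ∂ν ≤
      ENNReal.ofReal (L * M) := by
    calc _ ≤ ∫⁻ ω, ∑' m : ℕ, ENNReal.ofReal (t ^ (m+2) / ((m+2).factorial : ℝ) * |f ω| ^ (m+2)) ∂ν :=
          lintegral_mono hpt
      _ = ∑' m : ℕ, ∫⁻ ω, ENNReal.ofReal (t ^ (m+2) / ((m+2).factorial : ℝ) * |f ω| ^ (m+2)) ∂ν :=
          lintegral_tsum fun m =>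
            ((hfm (m+2) (by omega)).const_mul _).aestronglyMeasurable.aemeasurable.ennreal_ofReal
      _ ≤ ∑' m : ℕ, ENNReal.ofReal (t ^ 2 * s / 2 * M * (t * b) ^ m) := ENNReal.tsum_le_tsum hterm
      _ = ENNReal.ofReal (L * M) := by
        have hg := (hasSum_geometric_of_lt_one (by positivity : 0 ≤ t * b) htb).mul_left
          (t ^ 2 * s / 2 * M)
        rw [← ENNReal.ofReal_tsum_of_nonneg (fun m => by positivity) hg.summable, hg.tsum_eq, hL]
        congr 1
        field_simp
  have hI : Integrable (fun ω => Real.exp (t * f ω) - 1 - t * f ω) ν := by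
    refine ⟨hmeas, ?_⟩
    rw [hasFiniteIntegral_iff_ofReal (Eventually.of_forall hnn)]
    exact hlint.trans_lt ENNReal.ofReal_lt_top
  have hIle : ∫ ω, (Real.exp (t * f ω) - 1 - t * f ω) ∂ν ≤ L * M := by
    rw [integral_eq_lintegral_of_nonneg_ae (Eventually.of_forall hnn) hmeas]
    exact ENNReal.toReal_le_of_le_ofReal (by positivity) hlint
  have hI2 : Integrable (fun ω => 1 + t * f ω) ν := (integrable_const 1).add (hf.const_mul t)
  have hadd : (fun ω => Real.exp (t * f ω)) =
      fun ω => (Real.exp (t * f ω) - 1 - t * f ω) + (1 + t * f ω) := by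
    funext ω; ring
  have hIe : Integrable (fun ω => Real.exp (t * f ω)) ν := by
    rw [hadd]; exact hI.add hI2
  rw [← ofReal_integral_eq_lintegral_ofReal hIe (Eventually.of_forall fun ω => (Real.exp_pos _).le)]
  have hval : ∫ ω, Real.exp (t * f ω) ∂ν ≤ Real.exp L * M := by
    rw [hadd, integral_add hI hI2, integral_add (integrable_const 1) (hf.const_mul t),
      integral_const_mul, hf0]
    simp only [integral_const, smul_eq_mul, mul_one, mul_zero, add_zero]
    rw [← hM]
    nlinarith [mul_le_mul_of_nonneg_right (Real.add_one_le_exp L) hM0]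
  refine (ENNReal.ofReal_le_ofReal hval).trans_eq ?_
  rw [ENNReal.ofReal_mul (Real.exp_pos _).le, hM, ofReal_measureReal]

lemma aux_step {Ω : Type*} (G : MeasurableSpace Ω) {m0 : MeasurableSpace Ω}
    (P : Measure Ω) [IsProbabilityMeasure P] (hG : G ≤ m0) (g Y : Ω → ℝ≥0∞) (hg : Measurable g)
    (hY : Measurable[G] Y) (K : ℝ≥0∞)
    (h : ∀ A, MeasurableSet[G] A → ∫⁻ ω in A, g ω ∂P ≤ K * P A) :
    ∫⁻ ω, Y ω * g ω ∂P ≤ K * ∫⁻ ω, Y ω ∂P := by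
  have h1 : ∫⁻ ω, Y ω * g ω ∂P = ∫⁻ ω, Y ω ∂(P.withDensity g) := by
    rw [lintegral_withDensity_eq_lintegral_mul _ hg (hY.mono hG le_rfl)]
    simp [mul_comm]
  rw [h1, ← lintegral_smul_measure K Y |>.trans (smul_eq_mul _ _), ← lintegral_trim hG hY, ← lintegral_trim (μ := K • P) hG hY]
  refine lintegral_mono' ?_ le_rfl
  refine Measure.le_iff.2 fun A hA => ?_
  rw [trim_measurableSet_eq hG hA, trim_measurableSet_eq hG hA, withDensity_apply _ (hG _ hA)]
  simpa using h A hA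

/-- **Bernstein's inequality for martingales.**
If `(ξ i)` is a martingale difference sequence adapted to the filtration `𝓕`
(`𝓕 0` trivial) satisfying the conditional Bernstein moment condition with
parameters `(b, σ²)`, then for every `c > 0` and `n ∈ ℕ`,
`P(∑_{i=1}^n ξ i ≥ n c) ≤ exp(−n c² / (2 (b c + σ²)))`. -/
theorem stmt_0
    {Ω : Type*} {m0 : MeasurableSpace Ω} (P : Measure Ω) [IsProbabilityMeasure P]
    (𝓕 : Filtration ℕ m0) (h0 : 𝓕 0 = ⊥)
    (ξ : ℕ → Ω → ℝ) (b σ : ℝ) (hb : 0 < b) (hσ : 0 < σ ^ 2)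
    (hadapted : ∀ i, 1 ≤ i → StronglyMeasurable[𝓕 i] (ξ i))
    (hint : ∀ i, 1 ≤ i → Integrable (ξ i) P)
    (hmean : ∀ i, 1 ≤ i → P[ξ i | 𝓕 (i - 1)] =ᵐ[P] 0)
    (hintm : ∀ i, 1 ≤ i → ∀ m : ℕ, 2 ≤ m → Integrable (fun ω => |ξ i ω| ^ m) P)
    (hmom : ∀ i, 1 ≤ i → ∀ m : ℕ, 2 ≤ m →
      ∀ᵐ ω ∂P, (P[fun ω' => |ξ i ω'| ^ m | 𝓕 (i - 1)]) ω
        ≤ (m.factorial : ℝ) / 2 * b ^ (m - 2) * σ ^ 2) :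
    ∀ c : ℝ, 0 < c → ∀ n : ℕ,
      P {ω | (n : ℝ) * c ≤ ∑ i ∈ Finset.Icc 1 n, ξ i ω}
        ≤ ENNReal.ofReal (Real.exp (-((n : ℝ) * c ^ 2 / (2 * (b * c + σ ^ 2))))) := by

  intro c hc n
  set s := σ ^ 2 with hs
  have hD : 0 < b * c + s := by positivity
  set t := c / (b * c + s) with ht
  have ht0 : 0 < t := by positivity
  have h1tb : 1 - t * b = s / (b * c + s) := by rw [ht]; field_simp; ring
  have htb : t * b < 1 := by
    have : 0 < s / (b * c + s) := by positivity
    linarith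
  set L := t ^ 2 * s / (2 * (1 - t * b)) with hL
  have hLv : L = c ^ 2 / (2 * (b * c + s)) := by rw [hL, h1tb, ht]; field_simp
  have hset : ∀ i, 1 ≤ i → ∀ A, MeasurableSet[𝓕 (i-1)] A →
      ∫⁻ ω in A, ENNReal.ofReal (Real.exp (t * ξ i ω)) ∂P ≤ ENNReal.ofReal (Real.exp L) * P A := by
    intro i hi A hA
    have hle := 𝓕.le (i-1)
    have := aux_exp (P.restrict A) (ξ i) b s t hb hσ ht0 htb (hint i hi).restrict ?_
      (fun m hm => (hintm i hi m hm).restrict) ?_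
    · simpa using this
    · rw [← setIntegral_condExp hle (hint i hi) hA]
      rw [integral_congr_ae (ae_restrict_of_ae (hmean i hi))]
      simp
    · intro m hm
      rw [← setIntegral_condExp hle (hintm i hi m hm) hA]
      refine (integral_mono_ae integrable_condExp.restrict (integrable_const _)
        (ae_restrict_of_ae (hmom i hi m hm))).trans_eq ?_
      simp [mul_comm]
  have hSm : ∀ k, StronglyMeasurable[𝓕 k] (fun ω => ∑ i ∈ Finset.Icc 1 k, ξ i ω) := by
    intro k
    refine Finset.stronglyMeasurable_fun_sum _ fun i hi => ?_
    rw [Finset.mem_Icc] at hi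
    exact (hadapted i hi.1).mono (𝓕.mono hi.2)
  have hE : ∀ k, Measurable[𝓕 k]
      (fun ω => ENNReal.ofReal (Real.exp (t * ∑ i ∈ Finset.Icc 1 k, ξ i ω))) := fun k =>
    (Real.measurable_exp.comp ((hSm k).measurable.const_mul t)).ennreal_ofReal
  have hind : ∀ k : ℕ, ∫⁻ ω, ENNReal.ofReal (Real.exp (t * ∑ i ∈ Finset.Icc 1 k, ξ i ω)) ∂P ≤
      ENNReal.ofReal (Real.exp (k * L)) := by
    intro k
    induction k with
    | zero => simp
    | succ k ih =>
      have hk := aux_step (𝓕 k) P (𝓕.le k) (fun ω => ENNReal.ofReal (Real.exp (t * ξ (k+1) ω)))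
        _ ((Real.measurable_exp.comp (((hadapted (k+1) (by omega)).mono
          (𝓕.le (k+1))).measurable.const_mul t)).ennreal_ofReal) (hE k)
        (ENNReal.ofReal (Real.exp L)) (hset (k+1) (by omega))
      calc _ = ∫⁻ ω, ENNReal.ofReal (Real.exp (t * ∑ i ∈ Finset.Icc 1 k, ξ i ω)) *
            ENNReal.ofReal (Real.exp (t * ξ (k+1) ω)) ∂P := by
            refine lintegral_congr fun ω => ?_
            rw [← ENNReal.ofReal_mul (Real.exp_pos _).le, ← Real.exp_add, ← mul_add,
              Finset.sum_Icc_succ_top (by omega)]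
        _ ≤ _ := hk
        _ ≤ ENNReal.ofReal (Real.exp L) * ENNReal.ofReal (Real.exp (k * L)) := by gcongr
        _ = _ := by
            rw [← ENNReal.ofReal_mul (Real.exp_pos _).le, ← Real.exp_add]
            congr 2; push_cast; ring
  have hpos : ENNReal.ofReal (Real.exp (t * (n * c))) ≠ 0 := by simp [Real.exp_pos]
  have hmk := mul_meas_ge_le_lintegral (μ := P) ((hE n).mono (𝓕.le n) le_rfl)
    (ENNReal.ofReal (Real.exp (t * (n * c))))
  have hsub : P {ω | (n : ℝ) * c ≤ ∑ i ∈ Finset.Icc 1 n, ξ i ω} ≤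
      P {ω | ENNReal.ofReal (Real.exp (t * (n * c))) ≤
        ENNReal.ofReal (Real.exp (t * ∑ i ∈ Finset.Icc 1 n, ξ i ω))} := by
    refine measure_mono fun ω hω => ?_
    simp only [Set.mem_ofPred_eq] at hω ⊢
    gcongr
  refine hsub.trans ?_
  have h3 := hmk.trans (hind n)
  rw [mul_comm, ← ENNReal.le_div_iff_mul_le (Or.inl hpos) (Or.inl ENNReal.ofReal_ne_top)] at h3
  refine h3.trans_eq ?_
  rw [← ENNReal.ofReal_div_of_pos (Real.exp_pos _), ← Real.exp_sub]
  congr 2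
  rw [hLv, ht]; field_simp; ring
end

section
/- Let (Ω, F, P) be a probability space with a filtration F_0 ⊆ F_1 ⊆ … where F_0 is trivial, and let (ξ_j)_{j≥1} be real random variables such that ξ_j is F_j-measurable, E[ξ_j | F_{j−1}] = 0 almost surely, and E[|ξ_j|^m | F_{j−1}] ≤ (m!/2)·b^{m−2}·σ² almost surely for every integer m ≥ 2 and every j, with constants b > 0, σ² > 0. Then for every c > 0 and every integer N ≥ 1, P( there exists n ≥ N with | (1/n)·Σ_{j=1}^n ξ_j | > c ) ≤ 2·exp(−N·c₀) / (1 − exp(−c₀)), where c₀ = c² / (2(b·c + σ²)). -/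
open MeasureTheory ProbabilityTheory
open scoped ENNReal

lemma bern_exp_le (x : ℝ) : Real.exp x ≤ 1 + x + (Real.exp |x| - 1 - |x|) := by
  rcases le_total 0 x with h | h
  · rw [abs_of_nonneg h]; linarith
  · rw [abs_of_nonpos h]
    have h1 : -x ≤ Real.sinh (-x) := Real.self_le_sinh_iff.2 (by linarith)
    rw [Real.sinh_eq, neg_neg] at h1
    linarith

lemma bern_tendsto (x : ℝ) : Filter.Tendsto
    (fun k : ℕ => 1 + x + ∑ i ∈ Finset.range (k+1), |x| ^ (i+2) / ((i+2).factorial : ℝ))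
    Filter.atTop (nhds (1 + x + (Real.exp |x| - 1 - |x|))) := by
  have h := NormedSpace.expSeries_div_hasSum_exp (𝔸 := ℝ) |x|
  rw [← Real.exp_eq_exp_ℝ] at h
  have h2 := (hasSum_nat_add_iff' 2).2 h
  simp only [Finset.sum_range_succ, Finset.sum_range_zero] at h2
  have h3 := (Filter.tendsto_add_atTop_iff_nat 1).2 h2.tendsto_sum_nat
  have h4 := h3.const_add (1 + x)
  convert h4 using 2
  simp
  ring

lemma bern_nonneg (x : ℝ) (k : ℕ) :
    0 ≤ 1 + x + ∑ i ∈ Finset.range (k+1), |x| ^ (i+2) / ((i+2).factorial : ℝ) := by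
  rw [Finset.sum_range_succ']
  have : 0 ≤ ∑ i ∈ Finset.range k, |x| ^ (i+1+2) / ((i+1+2).factorial : ℝ) := by positivity
  have h2 : |x| ^ (0+2) / ((0+2).factorial : ℝ) = x ^ 2 / 2 := by
    simp [Nat.factorial]
  rw [h2]
  nlinarith [sq_nonneg (x+1)]

/-- integrated one-step bound -/
lemma bern_set {Ω : Type*} {m0 : MeasurableSpace Ω} (P : Measure Ω) [IsProbabilityMeasure P]
    (m : MeasurableSpace Ω) (hm : m ≤ m0) (X : Ω → ℝ) (b v t K : ℝ) (hb : 0 < b) (hv : 0 < v)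
    (htb : |t| * b < 1) (hK : 1 + v * t ^ 2 / (2 * (1 - |t| * b)) ≤ K)
    (hint : Integrable X P) (hmean : P[X | m] =ᵐ[P] 0)
    (hintm : ∀ k : ℕ, 2 ≤ k → Integrable (fun ω => |X ω| ^ k) P)
    (hmom : ∀ k : ℕ, 2 ≤ k → ∀ᵐ ω ∂P, (P[fun ω' => |X ω'| ^ k | m]) ω
        ≤ (k.factorial : ℝ) / 2 * b ^ (k - 2) * v)
    (hX : Measurable[m0] X) (s : Set Ω) (hs : MeasurableSet[m] s) :
    ∫⁻ ω in s, ENNReal.ofReal (Real.exp (t * X ω)) ∂P ≤ ENNReal.ofReal K * P s := by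
  have hmean_s : ∫ ω in s, X ω ∂P = 0 := by
    rw [← setIntegral_condExp hm hint hs]
    rw [integral_congr_ae (ae_restrict_of_ae hmean)]
    simp
  have hmom_s : ∀ k : ℕ, ∫ ω in s, |X ω| ^ (k+2) ∂P
      ≤ ((k+2).factorial : ℝ) / 2 * b ^ k * v * P.real s := by
    intro k
    rw [← setIntegral_condExp hm (hintm (k+2) (by omega)) hs]
    calc _ ≤ ∫ ω in s, (((k+2).factorial : ℝ) / 2 * b ^ k * v) ∂P := by
          apply integral_mono_ae integrable_condExp.integrableOn (integrable_const _)
          have := hmom (k+2) (by omega)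
          simp only [Nat.add_sub_cancel] at this
          exact ae_restrict_of_ae this
      _ = _ := by simp [mul_comm]
  set H : ℕ → Ω → ℝ := fun k ω =>
    1 + t * X ω + ∑ i ∈ Finset.range (k+1), |t * X ω| ^ (i+2) / ((i+2).factorial : ℝ) with hH
  have hterm : ∀ i : ℕ, Integrable
      (fun ω => |t * X ω| ^ (i+2) / ((i+2).factorial : ℝ)) P := by
    intro i
    simp only [abs_mul, mul_pow]
    exact ((hintm (i+2) (by omega)).const_mul _).div_const _
  have hlin : Integrable (fun ω => 1 + t * X ω) P := (integrable_const _).add (hint.const_mul t)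
  have hHint : ∀ k, Integrable (H k) P := fun k =>
    hlin.add (integrable_finsetSum _ fun i _ => hterm i)
  have hone : 0 < 1 - |t| * b := by linarith
  have hHle : ∀ k, ∫ ω in s, H k ω ∂P ≤ K * P.real s := by
    intro k
    have e1 : ∫ ω in s, H k ω ∂P = P.real s + ∑ i ∈ Finset.range (k+1),
        |t| ^ (i+2) * (∫ ω in s, |X ω| ^ (i+2) ∂P) / ((i+2).factorial : ℝ) := by
      rw [hH]
      simp only
      rw [integral_add hlin.integrableOn
        (integrable_finsetSum _ fun i _ => (hterm i).integrableOn),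
        integral_finsetSum _ fun i _ => (hterm i).integrableOn,
        integral_add (integrable_const _) (hint.const_mul t).integrableOn,
        integral_const_mul, hmean_s]
      simp [abs_mul, mul_pow, integral_div, integral_const_mul]
    have e2 : ∀ i ∈ Finset.range (k+1),
        |t| ^ (i+2) * (∫ ω in s, |X ω| ^ (i+2) ∂P) / ((i+2).factorial : ℝ)
        ≤ (v * t ^ 2 / 2 * P.real s) * (|t| * b) ^ i := by
      intro i _
      have hf : (0:ℝ) < ((i+2).factorial : ℝ) := by positivity
      rw [div_le_iff₀ hf]
      calc _ ≤ |t| ^ (i+2) * (((i+2).factorial : ℝ) / 2 * b ^ i * v * P.real s) := by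
            gcongr; exact hmom_s i
        _ = _ := by rw [← sq_abs t]; ring
    have e3 : ∑ i ∈ Finset.range (k+1), (|t| * b) ^ i ≤ (1 - |t| * b)⁻¹ :=
      sum_le_hasSum _ (fun i _ => by positivity)
        (hasSum_geometric_of_lt_one (by positivity) htb)
    rw [e1]
    calc _ ≤ P.real s + ∑ i ∈ Finset.range (k+1), (v * t ^ 2 / 2 * P.real s) * (|t| * b) ^ i := by
          gcongr with i hi; exact e2 i hi
      _ ≤ P.real s + (v * t ^ 2 / 2 * P.real s) * (1 - |t| * b)⁻¹ := by
          rw [← Finset.mul_sum]; gcongr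
      _ = (1 + v * t ^ 2 / (2 * (1 - |t| * b))) * P.real s := by
          field_simp
      _ ≤ _ := by gcongr
  have hHmeas : ∀ k, Measurable[m0] (H k) := by 
    intro k
    have hg : Measurable (fun x : ℝ => 1 + t * x +
      ∑ i ∈ Finset.range (k+1), |t * x| ^ (i+2) / ((i+2).factorial : ℝ)) := by fun_prop
    exact hg.comp hX
  calc _ ≤ ∫⁻ ω in s, Filter.liminf (fun k => ENNReal.ofReal (H k ω)) Filter.atTop ∂P := by
        apply lintegral_mono
        intro ω
        simp only
        have hl : Filter.liminf (fun k => ENNReal.ofReal (H k ω)) Filter.atTop = _ :=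
          ((ENNReal.continuous_ofReal.tendsto _).comp (bern_tendsto (t * X ω))).liminf_eq
        rw [hl]
        exact ENNReal.ofReal_le_ofReal (bern_exp_le _)
    _ ≤ Filter.liminf (fun k => ∫⁻ ω in s, ENNReal.ofReal (H k ω) ∂P) Filter.atTop :=
        lintegral_liminf_le fun k => (hHmeas k).ennreal_ofReal
    _ ≤ Filter.liminf (fun k : ℕ => ENNReal.ofReal K * P s) Filter.atTop := by
        refine Filter.liminf_le_liminf ?_
        filter_upwards with k
        rw [← ofReal_integral_eq_lintegral_ofReal (hHint k).integrableOn
          (Filter.Eventually.of_forall fun ω => bern_nonneg _ k)]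
        have hK0 : 0 ≤ K := le_trans (by positivity) hK
        rw [← ofReal_measureReal (μ := P) (s := s), ← ENNReal.ofReal_mul hK0]
        exact ENNReal.ofReal_le_ofReal (hHle k)
    _ = _ := by simp

lemma bern_mul {Ω : Type*} {m0 : MeasurableSpace Ω} (P : Measure Ω)
    (m : MeasurableSpace Ω) (hm : m ≤ m0) (f G : Ω → ℝ≥0∞) (K : ℝ≥0∞)
    (hf : Measurable[m0] f) (hG : Measurable[m] G)
    (h : ∀ s, MeasurableSet[m] s → ∫⁻ ω in s, f ω ∂P ≤ K * P s) :
    ∫⁻ ω, f ω * G ω ∂P ≤ K * ∫⁻ ω, G ω ∂P := by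
  have h1 : (P.withDensity f).trim hm ≤ K • P.trim hm := by
    rw [Measure.le_iff]
    intro s hs
    rw [trim_measurableSet_eq hm hs, withDensity_apply _ (hm s hs), Measure.smul_apply,
      trim_measurableSet_eq hm hs]
    exact h s hs
  have h2 := lintegral_withDensity_eq_lintegral_mul P hf (hG.mono hm le_rfl)
  simp only [Pi.mul_apply] at h2
  rw [← h2, ← lintegral_trim hm hG]
  calc _ ≤ ∫⁻ a, G a ∂(K • P.trim hm) := lintegral_mono' h1 le_rfl
    _ = _ := by rw [lintegral_smul_measure, lintegral_trim hm hG, smul_eq_mul]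

lemma bern_tail {Ω : Type*} {m0 : MeasurableSpace Ω} (P : Measure Ω) [IsProbabilityMeasure P]
    (𝓕 : Filtration ℕ m0) 
    (ξ : ℕ → Ω → ℝ) (b v : ℝ) (hb : 0 < b) (hv : 0 < v)
    (hadapted : ∀ j, 1 ≤ j → StronglyMeasurable[𝓕 j] (ξ j))
    (hint : ∀ j, 1 ≤ j → Integrable (ξ j) P)
    (hmean : ∀ j, 1 ≤ j → P[ξ j | 𝓕 (j - 1)] =ᵐ[P] 0)
    (hintm : ∀ j, 1 ≤ j → ∀ m : ℕ, 2 ≤ m → Integrable (fun ω => |ξ j ω| ^ m) P)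
    (hmom : ∀ j, 1 ≤ j → ∀ m : ℕ, 2 ≤ m →
      ∀ᵐ ω ∂P, (P[fun ω' => |ξ j ω'| ^ m | 𝓕 (j - 1)]) ω
        ≤ (m.factorial : ℝ) / 2 * b ^ (m - 2) * v)
    (c : ℝ) (hc : 0 < c) (e : ℝ) (he : |e| = 1) (n : ℕ) :
    P {ω | n * c ≤ e * ∑ j ∈ Finset.Icc 1 n, ξ j ω}
      ≤ ENNReal.ofReal (Real.exp (-(n : ℝ) * (c ^ 2 / (2 * (b * c + v))))) := by
  have hD : 0 < b * c + v := by positivity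
  set l := c / (b * c + v) with hl
  have hl0 : 0 < l := by positivity
  set c0 := c ^ 2 / (2 * (b * c + v)) with hc0
  have hlc : l * c = 2 * c0 := by rw [hl, hc0]; field_simp
  have habs : |l * e| = l := by rw [abs_mul, he, mul_one, abs_of_pos hl0]
  have hlb : 1 - l * b = v / (b * c + v) := by rw [hl]; field_simp; ring
  have hlb0 : 0 < 1 - l * b := by rw [hlb]; positivity
  have hK : 1 + v * (l * e) ^ 2 / (2 * (1 - |l * e| * b)) ≤ Real.exp c0 := by
    have : v * (l * e) ^ 2 / (2 * (1 - |l * e| * b)) = c0 := by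
      rw [← sq_abs (l * e), habs, hlb, hl, hc0]
      field_simp
    rw [this]
    linarith [Real.add_one_le_exp c0]
  have hSmeas : ∀ n, Measurable[𝓕 n] (fun ω => ∑ j ∈ Finset.Icc 1 n, ξ j ω) := by
    intro n
    refine @Finset.measurable_fun_sum _ _ _ _ _ _ (𝓕 n) _ _ fun j hj => ?_
    have := Finset.mem_Icc.1 hj
    exact ((hadapted j this.1).mono (𝓕.mono this.2)).measurable
  have hGmeas : ∀ n, Measurable[𝓕 n]
      (fun ω => ENNReal.ofReal (Real.exp (l * e * ∑ j ∈ Finset.Icc 1 n, ξ j ω))) := by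
    intro n
    exact (ENNReal.measurable_ofReal.comp Real.measurable_exp).comp
      (((measurable_const_mul (l * e))).comp (hSmeas n))
  have hmgf : ∀ n : ℕ, ∫⁻ ω, ENNReal.ofReal (Real.exp (l * e * ∑ j ∈ Finset.Icc 1 n, ξ j ω)) ∂P
      ≤ ENNReal.ofReal (Real.exp (n * c0)) := by
    intro n
    induction n with
    | zero => simp
    | succ n ih =>
      have hXm : Measurable (ξ (n+1)) :=
        ((hadapted (n+1) (by omega)).mono (𝓕.le _)).measurable
      have hstep := bern_mul P (𝓕 n) (𝓕.le n)
        (fun ω => ENNReal.ofReal (Real.exp (l * e * ξ (n+1) ω))) _ (ENNReal.ofReal (Real.exp c0))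
        ((ENNReal.measurable_ofReal.comp Real.measurable_exp).comp
          ((measurable_const_mul (l * e)).comp hXm)) (hGmeas n)
        (fun s hs => bern_set P (𝓕 n) (𝓕.le n) (ξ (n+1)) b v (l * e) (Real.exp c0) hb hv
          (by rw [habs]; linarith) hK (hint _ (by omega)) (hmean (n+1) (by omega))
          (hintm _ (by omega)) (hmom (n+1) (by omega)) hXm s hs)
      calc _ = ∫⁻ ω, ENNReal.ofReal (Real.exp (l * e * ξ (n+1) ω)) *
            ENNReal.ofReal (Real.exp (l * e * ∑ j ∈ Finset.Icc 1 n, ξ j ω)) ∂P := by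
            congr 1; ext ω
            rw [← ENNReal.ofReal_mul (Real.exp_nonneg _), ← Real.exp_add,
              Finset.sum_Icc_succ_top (by omega)]
            congr 2; ring
        _ ≤ _ := hstep
        _ ≤ ENNReal.ofReal (Real.exp c0) * ENNReal.ofReal (Real.exp (n * c0)) := by gcongr
        _ = _ := by
            rw [← ENNReal.ofReal_mul (Real.exp_nonneg _), ← Real.exp_add]
            congr 2; push_cast; ring
  have hsub : {ω | n * c ≤ e * ∑ j ∈ Finset.Icc 1 n, ξ j ω} ⊆
      {ω | ENNReal.ofReal (Real.exp (n * (2 * c0))) ≤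
        ENNReal.ofReal (Real.exp (l * e * ∑ j ∈ Finset.Icc 1 n, ξ j ω))} := by
    intro ω hω
    simp only [Set.mem_ofPred_eq] at hω ⊢
    apply ENNReal.ofReal_le_ofReal
    apply Real.exp_le_exp.2
    rw [← hlc]
    nlinarith
  have hmk := (mul_meas_ge_le_lintegral₀ ((hGmeas n).mono (𝓕.le n) le_rfl).aemeasurable
    (μ := P) (ENNReal.ofReal (Real.exp (n * (2 * c0))))).trans (hmgf n)
  refine (measure_mono hsub).trans ?_
  calc _ = ENNReal.ofReal (Real.exp (-(n * (2 * c0)))) * (ENNReal.ofReal (Real.exp (n * (2 * c0))) *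
        P {ω | ENNReal.ofReal (Real.exp (n * (2 * c0))) ≤
        ENNReal.ofReal (Real.exp (l * e * ∑ j ∈ Finset.Icc 1 n, ξ j ω))}) := by
        rw [← mul_assoc (ENNReal.ofReal _), ← ENNReal.ofReal_mul (Real.exp_nonneg _),
          ← Real.exp_add, neg_add_cancel]
        simp
    _ ≤ ENNReal.ofReal (Real.exp (-(n * (2 * c0)))) * ENNReal.ofReal (Real.exp (n * c0)) := by
        gcongr
    _ = _ := by
        rw [← ENNReal.ofReal_mul (Real.exp_nonneg _), ← Real.exp_add]
        congr 2; ring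

/-- **Uniform (geometric-series) Bernstein bound over sample sizes `n ≥ N`.**
For a martingale difference sequence satisfying the conditional Bernstein
moment condition with parameters `(b, σ²)`, the probability that the sample
mean of the first `n` terms exceeds `c` in absolute value for some `n ≥ N`
is at most `2 exp(−N c₀)/(1 − exp(−c₀))` with `c₀ = c²/(2(bc + σ²))`. -/
theorem stmt_7
    {Ω : Type*} {m0 : MeasurableSpace Ω} (P : Measure Ω) [IsProbabilityMeasure P]
    (𝓕 : Filtration ℕ m0) (h0 : 𝓕 0 = ⊥)
    (ξ : ℕ → Ω → ℝ) (b σ : ℝ) (hb : 0 < b) (hσ : 0 < σ ^ 2)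
    (hadapted : ∀ j, 1 ≤ j → StronglyMeasurable[𝓕 j] (ξ j))
    (hint : ∀ j, 1 ≤ j → Integrable (ξ j) P)
    (hmean : ∀ j, 1 ≤ j → P[ξ j | 𝓕 (j - 1)] =ᵐ[P] 0)
    (hintm : ∀ j, 1 ≤ j → ∀ m : ℕ, 2 ≤ m → Integrable (fun ω => |ξ j ω| ^ m) P)
    (hmom : ∀ j, 1 ≤ j → ∀ m : ℕ, 2 ≤ m →
      ∀ᵐ ω ∂P, (P[fun ω' => |ξ j ω'| ^ m | 𝓕 (j - 1)]) ω
        ≤ (m.factorial : ℝ) / 2 * b ^ (m - 2) * σ ^ 2) :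
    ∀ c : ℝ, 0 < c → ∀ N : ℕ, 1 ≤ N →
      P {ω | ∃ n : ℕ, N ≤ n ∧ c < |(n : ℝ)⁻¹ * ∑ j ∈ Finset.Icc 1 n, ξ j ω|}
        ≤ ENNReal.ofReal
            (2 * Real.exp (-(N : ℝ) * (c ^ 2 / (2 * (b * c + σ ^ 2))))
              / (1 - Real.exp (-(c ^ 2 / (2 * (b * c + σ ^ 2)))))) := by
  intro c hc N hN
  set c0 := c ^ 2 / (2 * (b * c + σ ^ 2)) with hc0
  have hc0p : 0 < c0 := by positivity
  have hr1 : Real.exp (-c0) < 1 := by simpa using hc0p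
  have hsub : {ω | ∃ n : ℕ, N ≤ n ∧ c < |(n : ℝ)⁻¹ * ∑ j ∈ Finset.Icc 1 n, ξ j ω|} ⊆
      ⋃ k : ℕ, ({ω | ((N + k : ℕ) : ℝ) * c ≤ 1 * ∑ j ∈ Finset.Icc 1 (N + k), ξ j ω} ∪
        {ω | ((N + k : ℕ) : ℝ) * c ≤ (-1) * ∑ j ∈ Finset.Icc 1 (N + k), ξ j ω}) := by
    rintro ω ⟨n, hn, hω⟩
    obtain ⟨k, rfl⟩ := Nat.exists_eq_add_of_le hn
    rw [Set.mem_iUnion]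
    refine ⟨k, ?_⟩
    have hpos : (0:ℝ) < ((N + k : ℕ) : ℝ) := by exact_mod_cast (by omega : 0 < N + k)
    rw [abs_mul, abs_of_pos (inv_pos.2 hpos), lt_inv_mul_iff₀ hpos, lt_abs] at hω
    rcases hω with h | h
    · left; simp only [Set.mem_ofPred_eq]; linarith
    · right; simp only [Set.mem_ofPred_eq]; linarith
  have ht := bern_tail P 𝓕 ξ b (σ ^ 2) hb hσ hadapted hint hmean hintm hmom c hc
  have hgeo : HasSum (fun k : ℕ => 2 * Real.exp (-((N + k : ℕ) : ℝ) * c0))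
      (2 * Real.exp (-(N : ℝ) * c0) / (1 - Real.exp (-c0))) := by
    have h := (hasSum_geometric_of_lt_one (Real.exp_nonneg (-c0)) hr1).mul_left
      (2 * Real.exp (-(N : ℝ) * c0))
    rw [← div_eq_mul_inv] at h
    have hfun : (fun k : ℕ => 2 * Real.exp (-((N + k : ℕ) : ℝ) * c0)) =
        fun k : ℕ => 2 * Real.exp (-(N : ℝ) * c0) * Real.exp (-c0) ^ k := by
      funext k
      rw [← Real.exp_nat_mul, mul_assoc, ← Real.exp_add]
      congr 2; push_cast; ring
    rw [hfun]
    exact h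
  calc _ ≤ _ := measure_mono hsub
    _ ≤ _ := measure_iUnion_le _
    _ ≤ ∑' k : ℕ, ENNReal.ofReal (2 * Real.exp (-((N + k : ℕ) : ℝ) * c0)) := by
        refine ENNReal.tsum_le_tsum fun k => (measure_union_le _ _).trans ?_
        refine (add_le_add (ht 1 (by simp) (N + k)) (ht (-1) (by simp) (N + k))).trans ?_
        rw [← ENNReal.ofReal_add (Real.exp_nonneg _) (Real.exp_nonneg _), ← two_mul]
    _ = _ := by
        rw [← ENNReal.ofReal_tsum_of_nonneg (fun k => by positivity) hgeo.summable, hgeo.tsum_eq]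
end

section
/- Let (Ω, F, P) be a probability space. For each integer k ≥ 2, let (E_{k,j})_{j≥1} be real random variables and (F_{k,j})_{j≥0} an increasing sequence of sub-σ-algebras of F such that E_{k,j} is F_{k,j}-measurable, E[E_{k,j} | F_{k,j−1}] = 0 almost surely, and E[|E_{k,j}|^m | F_{k,j−1}] ≤ (m!/2)·b^{m−2}·σ² almost surely for every integer m ≥ 2, with constants b > 0 and σ² > 0 not depending on k or j. Let ε_λ ∈ (0,1), λ₀ ≥ 2, ν > 0, set λ_k = λ₀·(log k)^{1+ε_λ}, and let N_k be positive-integer-valued random variables with N_k ≥ λ_k·ν almost surely for all k. Then for every κ > 0, P( | (1/N_k)·Σ_{j=1}^{N_k} E_{k,j} | > κ for infinitely many k ) = 0. -/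
open MeasureTheory ProbabilityTheory Filter
open scoped ENNReal

lemma aux_exp_s15 (x : ℝ) : ENNReal.ofReal (Real.exp x - 1 - x) ≤
    ∑' n : ℕ, ENNReal.ofReal (|x| ^ (n + 2) / ((n + 2).factorial : ℝ)) := by
  have h1 : HasSum (fun n : ℕ => x ^ n / (n.factorial : ℝ)) (Real.exp x) := by
    rw [Real.exp_eq_exp_ℝ]; exact NormedSpace.expSeries_div_hasSum_exp x
  have h1' : HasSum (fun n : ℕ => |x| ^ n / (n.factorial : ℝ)) (Real.exp |x|) := by
    rw [Real.exp_eq_exp_ℝ]; exact NormedSpace.expSeries_div_hasSum_exp |x|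
  have h2 := (hasSum_nat_add_iff' 2).2 h1
  have h2' := (hasSum_nat_add_iff' 2).2 h1'
  rw [← ENNReal.ofReal_tsum_of_nonneg (fun n => by positivity) h2'.summable]
  apply ENNReal.ofReal_le_ofReal
  have h3 : Real.exp x - 1 - x = ∑' n : ℕ, x ^ (n + 2) / ((n + 2).factorial : ℝ) := by
    rw [h2.tsum_eq]; simp [Finset.sum_range_succ]; ring
  rw [h3]
  refine Summable.tsum_le_tsum (fun n => ?_) h2.summable h2'.summable
  rw [← abs_pow]
  exact div_le_div_of_nonneg_right (le_abs_self _) (by positivity)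

lemma step_set {Ω : Type*} {m m0 : MeasurableSpace Ω} (P : Measure Ω) [IsProbabilityMeasure P]
    (hm : m ≤ m0) (X : Ω → ℝ) (b σ : ℝ) (hb : 0 < b)
    (hint : Integrable X P) (hmean : P[X | m] =ᵐ[P] 0)
    (hintm : ∀ i : ℕ, 2 ≤ i → Integrable (fun ω => |X ω| ^ i) P)
    (hmom : ∀ i : ℕ, 2 ≤ i → ∀ᵐ ω ∂P, (P[fun ω' => |X ω'| ^ i | m]) ω
        ≤ (i.factorial : ℝ) / 2 * b ^ (i - 2) * σ ^ 2)
    (t : ℝ) (ht : |t| * b ≤ 1 / 2) (A : Set Ω) (hA : MeasurableSet[m] A) :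
    ∫⁻ ω in A, ENNReal.ofReal (Real.exp (t * X ω)) ∂P
      ≤ ENNReal.ofReal (Real.exp (t ^ 2 * σ ^ 2)) * P A := by
  set p := P.real A with hp
  have hp0 : 0 ≤ p := measureReal_nonneg
  have hmomA : ∀ i : ℕ, 2 ≤ i → ∫ ω in A, |X ω| ^ i ∂P
      ≤ (i.factorial : ℝ) / 2 * b ^ (i - 2) * σ ^ 2 * p := by
    intro i hi
    rw [← setIntegral_condExp hm (hintm i hi) hA]
    calc _ ≤ ∫ ω in A, (i.factorial : ℝ) / 2 * b ^ (i - 2) * σ ^ 2 ∂P :=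
          setIntegral_mono_ae integrable_condExp.integrableOn (integrableOn_const (by simp)) (hmom i hi)
      _ = _ := by rw [setIntegral_const, smul_eq_mul, mul_comm]
  have hX0 : ∫ ω in A, X ω ∂P = 0 := by
    rw [← setIntegral_condExp hm hint hA]
    rw [setIntegral_congr_ae (g := fun _ => (0:ℝ)) (hm _ hA) (hmean.mono fun ω h _ => h)]
    simp
  have hterm : ∀ n : ℕ, ∫⁻ ω in A, ENNReal.ofReal (|t * X ω| ^ (n + 2) / ((n + 2).factorial : ℝ)) ∂P
      ≤ ENNReal.ofReal (t ^ 2 * σ ^ 2 * p / 2 * (1 / 2) ^ n) := by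
    intro n
    have e : ∀ ω, |t * X ω| ^ (n + 2) / ((n + 2).factorial : ℝ)
        = |t| ^ (n + 2) / ((n + 2).factorial : ℝ) * |X ω| ^ (n + 2) := by
      intro ω; rw [abs_mul, mul_pow]; ring
    simp_rw [e]
    rw [← ofReal_integral_eq_lintegral_ofReal ((hintm (n+2) (by omega)).integrableOn.const_mul _)
      (Eventually.of_forall fun ω => by positivity), integral_const_mul]
    apply ENNReal.ofReal_le_ofReal
    have h := hmomA (n + 2) (by omega)
    have hf : (0 : ℝ) < ((n + 2).factorial : ℝ) := by positivity
    calc |t| ^ (n + 2) / ((n + 2).factorial : ℝ) * ∫ ω in A, |X ω| ^ (n + 2) ∂P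
        ≤ |t| ^ (n + 2) / ((n + 2).factorial : ℝ) *
          (((n + 2).factorial : ℝ) / 2 * b ^ (n + 2 - 2) * σ ^ 2 * p) := by gcongr
      _ = |t| ^ 2 * σ ^ 2 * p / 2 * (|t| * b) ^ n := by
          rw [Nat.add_sub_cancel, mul_pow, pow_add]; field_simp
      _ ≤ |t| ^ 2 * σ ^ 2 * p / 2 * (1 / 2) ^ n := by gcongr
      _ = _ := by rw [sq_abs]
  have hnn : ∀ x : ℝ, 0 ≤ Real.exp x - 1 - x := fun x => by linarith [Real.add_one_le_exp x]
  have hXae : AEMeasurable X (P.restrict A) := hint.aestronglyMeasurable.aemeasurable.restrict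
  have hh : ∫⁻ ω in A, ENNReal.ofReal (Real.exp (t * X ω) - 1 - t * X ω) ∂P
      ≤ ENNReal.ofReal (t ^ 2 * σ ^ 2 * p) := by
    calc _ ≤ ∫⁻ ω in A, ∑' n : ℕ,
          ENNReal.ofReal (|t * X ω| ^ (n + 2) / ((n + 2).factorial : ℝ)) ∂P :=
          lintegral_mono fun ω => aux_exp_s15 _
      _ = ∑' n : ℕ, ∫⁻ ω in A, 
          ENNReal.ofReal (|t * X ω| ^ (n + 2) / ((n + 2).factorial : ℝ)) ∂P := by
          apply lintegral_tsum; intro n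
          fun_prop
      _ ≤ ∑' n : ℕ, ENNReal.ofReal (t ^ 2 * σ ^ 2 * p / 2 * (1 / 2) ^ n) :=
          ENNReal.tsum_le_tsum hterm
      _ = _ := by
          rw [← ENNReal.ofReal_tsum_of_nonneg (fun n => by positivity)
            (summable_geometric_two.mul_left _), tsum_mul_left, tsum_geometric_two]
          congr 1; ring
  have hmeas : AEMeasurable (fun ω => Real.exp (t * X ω) - 1 - t * X ω) (P.restrict A) := by
    fun_prop
  have hI : Integrable (fun ω => Real.exp (t * X ω) - 1 - t * X ω) (P.restrict A) := by
    refine ⟨hmeas.aestronglyMeasurable, ?_⟩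
    rw [hasFiniteIntegral_iff_ofReal (Eventually.of_forall fun ω => hnn _)]
    exact hh.trans_lt ENNReal.ofReal_lt_top
  have hI2 : Integrable (fun ω => 1 + t * X ω) (P.restrict A) :=
    (integrable_const _).add (hint.integrableOn.const_mul t)
  have e2 : ∀ ω, Real.exp (t * X ω) = (Real.exp (t * X ω) - 1 - t * X ω) + (1 + t * X ω) := by
    intro ω; ring
  have hIe : Integrable (fun ω => Real.exp (t * X ω)) (P.restrict A) := by
    refine (hI.add hI2).congr (Eventually.of_forall fun ω => ?_)
    simp
  rw [← ofReal_integral_eq_lintegral_ofReal hIe (Eventually.of_forall fun ω => (Real.exp_pos _).le)]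
  have h5 : ∫ ω in A, Real.exp (t * X ω) - 1 - t * X ω ∂P ≤ t ^ 2 * σ ^ 2 * p := by
    rw [← ofReal_integral_eq_lintegral_ofReal hI (Eventually.of_forall fun ω => hnn _)] at hh
    exact (ENNReal.ofReal_le_ofReal_iff (by positivity)).1 hh
  have h6 : ∫ ω in A, (1 + t * X ω) ∂P = p := by
    rw [integral_add (integrable_const _) (hint.integrableOn.const_mul t), integral_const_mul, hX0]
    simp [hp]
  have h7 : ∫ ω in A, Real.exp (t * X ω) ∂P ≤ Real.exp (t ^ 2 * σ ^ 2) * p := by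
    rw [integral_congr_ae (Eventually.of_forall e2), integral_add hI hI2, h6]
    nlinarith [Real.add_one_le_exp (t ^ 2 * σ ^ 2)]
  calc _ ≤ ENNReal.ofReal (Real.exp (t ^ 2 * σ ^ 2) * p) := ENNReal.ofReal_le_ofReal h7
    _ = _ := by rw [ENNReal.ofReal_mul (Real.exp_pos _).le, hp, ofReal_measureReal]

lemma step_mul {Ω : Type*} {m m0 : MeasurableSpace Ω} (P : Measure Ω) [IsProbabilityMeasure P]
    (hm : m ≤ m0) (f Y : Ω → ℝ≥0∞) (hf : Measurable[m0] f) (hY : Measurable[m] Y) (C : ℝ≥0∞)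
    (h : ∀ A, MeasurableSet[m] A → ∫⁻ ω in A, f ω ∂P ≤ C * P A) :
    ∫⁻ ω, Y ω * f ω ∂P ≤ C * ∫⁻ ω, Y ω ∂P := by
  have hle : (P.withDensity f).trim hm ≤ C • P.trim hm := by
    refine Measure.le_iff.2 fun A hA => ?_
    rw [trim_measurableSet_eq hm hA, withDensity_apply _ (hm _ hA), Measure.smul_apply,
      trim_measurableSet_eq hm hA]
    exact h A hA
  calc ∫⁻ ω, Y ω * f ω ∂P = ∫⁻ ω, Y ω ∂(P.withDensity f) := by
        rw [lintegral_withDensity_eq_lintegral_mul _ hf (hY.mono hm le_rfl)]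
        simp [mul_comm]
    _ = ∫⁻ ω, Y ω ∂((P.withDensity f).trim hm) := (lintegral_trim hm hY).symm
    _ ≤ ∫⁻ ω, Y ω ∂(C • P.trim hm) := lintegral_mono' hle le_rfl
    _ = _ := by rw [lintegral_smul_measure, lintegral_trim hm hY, smul_eq_mul]

lemma mgf_bound {Ω : Type*} {m0 : MeasurableSpace Ω} (P : Measure Ω) [IsProbabilityMeasure P]
    (E : ℕ → Ω → ℝ) (𝓕 : ℕ → MeasurableSpace Ω)
    (hFle : ∀ j, 𝓕 j ≤ m0) (hFmono : Monotone 𝓕)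
    (b σ : ℝ) (hb : 0 < b)
    (hadapted : ∀ j, 1 ≤ j → StronglyMeasurable[𝓕 j] (E j))
    (hint : ∀ j, 1 ≤ j → Integrable (E j) P)
    (hmean : ∀ j, 1 ≤ j → P[E j | 𝓕 (j - 1)] =ᵐ[P] 0)
    (hintm : ∀ j, 1 ≤ j → ∀ m : ℕ, 2 ≤ m → Integrable (fun ω => |E j ω| ^ m) P)
    (hmom : ∀ j, 1 ≤ j → ∀ m : ℕ, 2 ≤ m →
      ∀ᵐ ω ∂P, (P[fun ω' => |E j ω'| ^ m | 𝓕 (j - 1)]) ω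
        ≤ (m.factorial : ℝ) / 2 * b ^ (m - 2) * σ ^ 2)
    (t : ℝ) (ht : |t| * b ≤ 1 / 2) (n : ℕ) :
    ∫⁻ ω, ENNReal.ofReal (Real.exp (t * ∑ j ∈ Finset.Icc 1 n, E j ω)) ∂P
      ≤ ENNReal.ofReal (Real.exp (t ^ 2 * σ ^ 2)) ^ n := by
  induction n with
  | zero => simp
  | succ n ih =>
    have hS : Measurable[𝓕 n] (fun ω => ∑ j ∈ Finset.Icc 1 n, E j ω) := by
      refine Finset.measurable_fun_sum _ fun j hj => ?_
      rw [Finset.mem_Icc] at hj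
      exact ((hadapted j hj.1).mono (hFmono hj.2)).measurable
    have hE : Measurable[m0] (E (n + 1)) :=
      ((hadapted (n+1) (by omega)).mono (hFle _)).measurable
    have key := step_mul P (hFle n) (fun ω => ENNReal.ofReal (Real.exp (t * E (n + 1) ω)))
      (fun ω => ENNReal.ofReal (Real.exp (t * ∑ j ∈ Finset.Icc 1 n, E j ω)))
      (by fun_prop) ((Real.measurable_exp.comp (hS.const_mul t)).ennreal_ofReal) 
      (ENNReal.ofReal (Real.exp (t ^ 2 * σ ^ 2)))
      (fun A hA => step_set P (hFle n) (E (n + 1)) b σ hb (hint _ (by omega))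
        (hmean (n + 1) (by omega)) (hintm _ (by omega)) (hmom (n + 1) (by omega)) t ht A hA)
    calc _ = ∫⁻ ω, ENNReal.ofReal (Real.exp (t * ∑ j ∈ Finset.Icc 1 n, E j ω)) *
          ENNReal.ofReal (Real.exp (t * E (n + 1) ω)) ∂P := by
          refine lintegral_congr fun ω => ?_
          rw [Finset.sum_Icc_succ_top (by omega), mul_add, Real.exp_add,
            ENNReal.ofReal_mul (Real.exp_pos _).le]
      _ ≤ _ := key
      _ ≤ _ := by rw [pow_succ' _ n]; exact mul_le_mul_right ih _

/-- one-sided Chernoff -/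
lemma chernoff {Ω : Type*} {m0 : MeasurableSpace Ω} (P : Measure Ω) (S : Ω → ℝ)
    (t v κ : ℝ) (n : ℕ) (hS : Measurable S)
    (h : ∫⁻ ω, ENNReal.ofReal (Real.exp (t * S ω)) ∂P ≤ ENNReal.ofReal (Real.exp v) ^ n) :
    P {ω | κ * n < t * S ω} ≤ ENNReal.ofReal (Real.exp (v - κ)) ^ n := by
  have h1 := mul_meas_ge_le_lintegral (μ := P)
    (f := fun ω => ENNReal.ofReal (Real.exp (t * S ω))) (by fun_prop)
    (ENNReal.ofReal (Real.exp (κ * n)))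
  have hsub : P {ω | κ * n < t * S ω} ≤ P {ω | ENNReal.ofReal (Real.exp (κ * n)) ≤
      ENNReal.ofReal (Real.exp (t * S ω))} := by
    apply measure_mono
    intro ω hω
    exact ENNReal.ofReal_le_ofReal (Real.exp_le_exp.2 (le_of_lt hω))
  have h2 := (mul_le_mul_right hsub (ENNReal.ofReal (Real.exp (κ * n)))).trans (h1.trans h)
  have e : ENNReal.ofReal (Real.exp (-(κ * n))) * ENNReal.ofReal (Real.exp (κ * n)) = 1 := by
    rw [← ENNReal.ofReal_mul (Real.exp_pos _).le, ← Real.exp_add]; simp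
  calc P {ω | κ * n < t * S ω} = ENNReal.ofReal (Real.exp (-(κ * n))) *
      (ENNReal.ofReal (Real.exp (κ * n)) * P {ω | κ * n < t * S ω}) := by
        rw [← mul_assoc, e, one_mul]
    _ ≤ ENNReal.ofReal (Real.exp (-(κ * n))) * ENNReal.ofReal (Real.exp v) ^ n := by gcongr
    _ = _ := by
      rw [← ENNReal.ofReal_pow (Real.exp_pos _).le, ← ENNReal.ofReal_pow (Real.exp_pos _).le,
        ← ENNReal.ofReal_mul (Real.exp_pos _).le, ← Real.exp_nat_mul, ← Real.exp_nat_mul,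
        ← Real.exp_add]
      congr 2; ring

lemma summable_aux (c ε : ℝ) (hc : 0 < c) (hε : 0 < ε) :
    Summable (fun k : ℕ => Real.exp (-(c * Real.log k ^ (1 + ε)))) := by
  have hlim : Tendsto (fun k : ℕ => c * Real.log k ^ ε) atTop atTop :=
    ((tendsto_rpow_atTop hε).comp
      (Real.tendsto_log_atTop.comp tendsto_natCast_atTop_atTop)).const_mul_atTop hc
  have hs : Summable (fun k : ℕ => 1 / (k : ℝ) ^ 2) :=
    Real.summable_one_div_nat_pow.2 (by norm_num)
  refine Summable.of_norm_bounded_eventually_nat hs ?_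
  filter_upwards [hlim.eventually_ge_atTop 2, eventually_ge_atTop 2] with k hk hk2
  have hk0 : (0 : ℝ) < k := by positivity
  have hl : 0 < Real.log k := Real.log_pos (by exact_mod_cast hk2)
  rw [Real.norm_of_nonneg (Real.exp_pos _).le, Real.rpow_add hl, Real.rpow_one]
  have : 1 / (k : ℝ) ^ 2 = Real.exp (-(2 * Real.log k)) := by
    rw [Real.exp_neg, one_div, mul_comm, Real.exp_mul, Real.exp_log hk0]; norm_num
  rw [this]
  apply Real.exp_le_exp.2
  nlinarith

/-- **Almost-sure control of adaptively sampled estimation errors.**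
If within each iteration `k ≥ 2` the observation errors `(E k j)_j` form a
martingale difference array satisfying the conditional Bernstein moment
condition with uniform parameters `(b, σ²)`, and the adaptive sample size
`N k` satisfies `N k ≥ λ_k ν` with `λ_k = lam0 (log k)^{1+ε_λ}`, then for every
`κ > 0`, almost surely the sample-mean error exceeds `κ` only finitely often. -/
theorem stmt_15
    {Ω : Type*} {m0 : MeasurableSpace Ω} (P : Measure Ω) [IsProbabilityMeasure P]
    (E : ℕ → ℕ → Ω → ℝ) (𝓕 : ℕ → ℕ → MeasurableSpace Ω)
    (hFle : ∀ k j, 𝓕 k j ≤ m0) (hFmono : ∀ k, Monotone (𝓕 k))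
    (b σ : ℝ) (hb : 0 < b) (hσ : 0 < σ ^ 2)
    (hadapted : ∀ k, 2 ≤ k → ∀ j, 1 ≤ j → StronglyMeasurable[𝓕 k j] (E k j))
    (hint : ∀ k, 2 ≤ k → ∀ j, 1 ≤ j → Integrable (E k j) P)
    (hmean : ∀ k, 2 ≤ k → ∀ j, 1 ≤ j → P[E k j | 𝓕 k (j - 1)] =ᵐ[P] 0)
    (hintm : ∀ k, 2 ≤ k → ∀ j, 1 ≤ j → ∀ m : ℕ, 2 ≤ m →
      Integrable (fun ω => |E k j ω| ^ m) P)
    (hmom : ∀ k, 2 ≤ k → ∀ j, 1 ≤ j → ∀ m : ℕ, 2 ≤ m →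
      ∀ᵐ ω ∂P, (P[fun ω' => |E k j ω'| ^ m | 𝓕 k (j - 1)]) ω
        ≤ (m.factorial : ℝ) / 2 * b ^ (m - 2) * σ ^ 2)
    (εlam lam0 ν : ℝ) (hεlam : εlam ∈ Set.Ioo (0 : ℝ) 1) (hlam0 : 2 ≤ lam0) (hν : 0 < ν)
    (N : ℕ → Ω → ℕ) (hNmeas : ∀ k, Measurable (N k))
    (hNpos : ∀ k, ∀ᵐ ω ∂P, 1 ≤ N k ω)
    (hN : ∀ k : ℕ, 2 ≤ k →
      ∀ᵐ ω ∂P, lam0 * Real.log (k : ℝ) ^ ((1 : ℝ) + εlam) * ν ≤ (N k ω : ℝ)) :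
    ∀ κ : ℝ, 0 < κ →
      P {ω | ∃ᶠ k in atTop,
        κ < |((N k ω : ℝ))⁻¹ * ∑ j ∈ Finset.Icc 1 (N k ω), E k j ω|} = 0 := by
  intro κ hκ
  obtain ⟨hε, -⟩ := hεlam
  set t : ℝ := min (1 / (2 * b)) (κ / (2 * σ ^ 2)) with htdef
  have ht0 : 0 < t := lt_min (by positivity) (by positivity)
  have htb : |t| * b ≤ 1 / 2 := by
    rw [abs_of_pos ht0]
    calc t * b ≤ 1 / (2 * b) * b := by gcongr; exact min_le_left _ _
      _ = 1 / 2 := by field_simp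
  have htσ : t * σ ^ 2 ≤ κ / 2 := by
    calc t * σ ^ 2 ≤ κ / (2 * σ ^ 2) * σ ^ 2 := by gcongr; exact min_le_right _ _
      _ = κ / 2 := by
        have : σ ≠ 0 := by rintro rfl; simp at hσ
        field_simp
  set c : ℝ := t * κ / 2 with hc
  have hc0 : 0 < c := by positivity
  set r : ℝ := Real.exp (-c) with hr
  have hr0 : 0 < r := Real.exp_pos _
  have hr1 : r < 1 := (Real.exp_lt_exp.2 (by linarith)).trans_eq Real.exp_zero
  have hexp : Real.exp (t ^ 2 * σ ^ 2 - t * κ) ≤ r := by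
    apply Real.exp_le_exp.2; rw [hc]; nlinarith
  have htail : ∀ k, 2 ≤ k → ∀ n : ℕ,
      P {ω | κ * n < |∑ j ∈ Finset.Icc 1 n, E k j ω|} ≤ ENNReal.ofReal (2 * r ^ n) := by
    intro k hk n
    have hS : Measurable (fun ω => ∑ j ∈ Finset.Icc 1 n, E k j ω) := by
      refine Finset.measurable_fun_sum _ fun j hj => ?_
      rw [Finset.mem_Icc] at hj
      exact ((hadapted k hk j hj.1).mono (hFle k j)).measurable
    have hmgf := fun s hs => mgf_bound P (E k) (𝓕 k) (hFle k) (hFmono k) b σ hb (hadapted k hk)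
      (hint k hk) (hmean k hk) (hintm k hk) (hmom k hk) s hs n
    have h1 := chernoff P _ t (t ^ 2 * σ ^ 2) (t * κ) n hS (hmgf t htb)
    have h2 := chernoff P _ (-t) (t ^ 2 * σ ^ 2) (t * κ) n hS
      (by simpa only [neg_sq] using hmgf (-t) (by rwa [abs_neg]))
    have hsub : {ω | κ * n < |∑ j ∈ Finset.Icc 1 n, E k j ω|} ⊆
        {ω | t * κ * n < t * ∑ j ∈ Finset.Icc 1 n, E k j ω} ∪
        {ω | t * κ * n < -t * ∑ j ∈ Finset.Icc 1 n, E k j ω} := by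
      intro ω hω
      rcases lt_abs.1 (show κ * n < |∑ j ∈ Finset.Icc 1 n, E k j ω| from hω) with h | h
      · left
        have := mul_lt_mul_of_pos_left h ht0
        simp only [Set.mem_setOf_eq]; linarith
      · right
        have := mul_lt_mul_of_pos_left h ht0
        simp only [Set.mem_setOf_eq]; linarith
    have hE' : ENNReal.ofReal (Real.exp (t ^ 2 * σ ^ 2 - t * κ)) ^ n ≤ ENNReal.ofReal (r ^ n) := by
      rw [ENNReal.ofReal_pow hr0.le]; gcongr
    calc _ ≤ _ := measure_mono hsub
      _ ≤ _ := measure_union_le _ _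
      _ ≤ ENNReal.ofReal (r ^ n) + ENNReal.ofReal (r ^ n) :=
          add_le_add (h1.trans hE') (h2.trans hE')
      _ = _ := by rw [← ENNReal.ofReal_add (by positivity) (by positivity)]; congr 1; ring
  set L : ℕ → ℝ := fun k => lam0 * Real.log (k : ℝ) ^ ((1 : ℝ) + εlam) * ν with hL
  have hbd : ∀ k, 2 ≤ k →
      P {ω | κ < |((N k ω : ℝ))⁻¹ * ∑ j ∈ Finset.Icc 1 (N k ω), E k j ω|} ≤
        ENNReal.ofReal (2 * (1 - r)⁻¹ * Real.exp (-(c * lam0 * ν *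
          Real.log k ^ (1 + εlam)))) := by
    intro k hk
    have hsub : {ω | κ < |((N k ω : ℝ))⁻¹ * ∑ j ∈ Finset.Icc 1 (N k ω), E k j ω|} ≤ᵐ[P]
        ⋃ i : ℕ, {ω | κ * ((⌈L k⌉₊ + i : ℕ) : ℝ) <
          |∑ j ∈ Finset.Icc 1 (⌈L k⌉₊ + i), E k j ω|} := by
      filter_upwards [hNpos k, hN k hk] with ω h1 h2 h3
      have h3' : κ < |((N k ω : ℝ))⁻¹ * ∑ j ∈ Finset.Icc 1 (N k ω), E k j ω| := h3
      obtain ⟨i, hi⟩ := Nat.exists_eq_add_of_le (Nat.ceil_le.2 h2)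
      refine Set.mem_iUnion.2 ⟨i, ?_⟩
      have hi' : ⌈L k⌉₊ + i = N k ω := hi.symm
      have hNp : (0 : ℝ) < N k ω := by exact_mod_cast h1
      simp only [Set.mem_setOf_eq]
      rw [hi']
      rw [abs_mul, abs_of_pos (inv_pos.2 hNp), inv_mul_eq_div, lt_div_iff₀ hNp] at h3'
      exact h3'
    have hsum : Summable (fun i : ℕ => r ^ i) := summable_geometric_of_lt_one hr0.le hr1
    calc _ ≤ _ := measure_mono_ae hsub
      _ ≤ _ := measure_iUnion_le _
      _ ≤ ∑' i : ℕ, ENNReal.ofReal (2 * r ^ (⌈L k⌉₊ + i)) :=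
          ENNReal.tsum_le_tsum fun i => htail k hk _
      _ = ENNReal.ofReal (2 * r ^ ⌈L k⌉₊ * (1 - r)⁻¹) := by
          simp_rw [pow_add, ← mul_assoc]
          rw [← ENNReal.ofReal_tsum_of_nonneg (fun i => by positivity) (hsum.mul_left _),
            tsum_mul_left, tsum_geometric_of_lt_one hr0.le hr1]
      _ ≤ _ := by
          apply ENNReal.ofReal_le_ofReal
          have h1r : 0 < 1 - r := by linarith
          have : r ^ ⌈L k⌉₊ ≤ Real.exp (-(c * lam0 * ν * Real.log k ^ (1 + εlam))) := by
            rw [hr, ← Real.exp_nat_mul]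
            apply Real.exp_le_exp.2
            have := Nat.le_ceil (L k)
            have h9 : c * L k = c * lam0 * ν * Real.log k ^ (1 + εlam) := by
              simp only [hL]; ring
            rw [← h9]
            nlinarith
          calc _ ≤ 2 * Real.exp (-(c * lam0 * ν * Real.log k ^ (1 + εlam))) * (1 - r)⁻¹ := by
                gcongr
            _ = _ := by ring
  have hsm : Summable (fun k : ℕ => 2 * (1 - r)⁻¹ * Real.exp (-(c * lam0 * ν *
          Real.log k ^ (1 + εlam)))) :=
    (summable_aux (c * lam0 * ν) εlam (by positivity) hε).mul_left _
  have hBC := measure_setOf_frequently_eq_zero (μ := P) (p := fun (k : ℕ) ω => 2 ≤ k ∧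
      κ < |((N k ω : ℝ))⁻¹ * ∑ j ∈ Finset.Icc 1 (N k ω), E k j ω|) (by
    refine ne_top_of_le_ne_top hsm.tsum_ofReal_ne_top (ENNReal.tsum_le_tsum fun k => ?_)
    by_cases hk : 2 ≤ k
    · simpa only [hk, true_and] using hbd k hk
    · simp [hk])
  refine measure_mono_null (fun ω hω => ?_) hBC
  have hω' : ∃ᶠ k in atTop, κ < |((N k ω : ℝ))⁻¹ * ∑ j ∈ Finset.Icc 1 (N k ω), E k j ω| := hω
  exact ((eventually_ge_atTop 2).and_frequently hω')
end
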